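/- Let ρ_ABC and σ_ABC be density matrices on H_A ⊗ H_B ⊗ H_C with ρ_AB = σ_AB and ρ_BC = σ_BC, and let τ_ABC = (ρ_ABC + σ_ABC)/2. Then S(τ_ABC) − (S(ρ_ABC) + S(σ_ABC))/2 ≤ (I(A:C|B)_ρ + I(A:C|B)_σ)/2. -/

import Mathlib

open Matrix Kronecker BigOperators
open scoped ComplexOrder

/-- A density matrix: a positive semidefinite matrix of trace one. -/
def IsDensityMatrix {n : Type*} [Fintype n] (ρ : Matrix n n ℂ) : Prop :=
  ρ.PosSemidef ∧ ρ.trace = 1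

/-- `P` is the orthogonal projection onto the support of `ρ`, i.e. `P` is a Hermitian
idempotent whose kernel is exactly the kernel of `ρ`. -/
def IsSupportProj {n : Type*} [Fintype n] (ρ P : Matrix n n ℂ) : Prop :=
  P.IsHermitian ∧ P * P = P ∧ ∀ v : n → ℂ, ρ.mulVec v = 0 ↔ P.mulVec v = 0

/-- The von Neumann entropy `S(ρ) = -Tr(ρ log ρ)`, computed via the eigenvalues of a
Hermitian matrix (with the convention `0 log 0 = 0`). -/
noncomputable def vNEntropy {n : Type*} [Fintype n] [DecidableEq n]
    (ρ : Matrix n n ℂ) : ℝ :=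
  if h : ρ.IsHermitian then -∑ i, h.eigenvalues i * Real.log (h.eigenvalues i) else 0

/-- Reduced density matrix on `A × B` (partial trace over `C`). -/
noncomputable def margAB {A B C : Type*} [Fintype C]
    (ρ : Matrix (A × B × C) (A × B × C) ℂ) : Matrix (A × B) (A × B) ℂ :=
  Matrix.of fun p q => ∑ c : C, ρ (p.1, p.2, c) (q.1, q.2, c)

/-- Reduced density matrix on `B × C` (partial trace over `A`). -/
noncomputable def margBC {A B C : Type*} [Fintype A]
    (ρ : Matrix (A × B × C) (A × B × C) ℂ) : Matrix (B × C) (B × C) ℂ :=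
  Matrix.of fun p q => ∑ a : A, ρ (a, p) (a, q)

/-- Reduced density matrix on `B` (partial trace over `A` and `C`). -/
noncomputable def margB {A B C : Type*} [Fintype A] [Fintype C]
    (ρ : Matrix (A × B × C) (A × B × C) ℂ) : Matrix B B ℂ :=
  Matrix.of fun b b' => ∑ a : A, ∑ c : C, ρ (a, b, c) (a, b', c)

/-- Conditional mutual information `I(A:C|B) = S(AB) + S(BC) - S(B) - S(ABC)`. -/
noncomputable def CMI {A B C : Type*} [Fintype A] [DecidableEq A]
    [Fintype B] [DecidableEq B] [Fintype C] [DecidableEq C]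
    (ρ : Matrix (A × B × C) (A × B × C) ℂ) : ℝ :=
  vNEntropy (margAB ρ) + vNEntropy (margBC ρ) - vNEntropy (margB ρ) - vNEntropy ρ

open Filter Topology

section Scalar

variable {ι κ : Type*} [Fintype ι] [Fintype κ]

/-- Derivative of a weighted sum of `p log (q + t p)` in `t`. -/
lemma hasDerivAt_sum_mul_log (w p q : ι → ℝ) (hp : ∀ i, 0 ≤ p i) (hq : ∀ i, 0 < q i)
    {t : ℝ} (ht : 0 ≤ t) :
    HasDerivAt (fun t => ∑ i, w i * (p i * Real.log (q i + t * p i)))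
      (∑ i, w i * (p i ^ 2 / (q i + t * p i))) t := by
  refine HasDerivAt.fun_sum fun i _ => ?_
  have hpos : q i + t * p i ≠ 0 := (add_pos_of_pos_of_nonneg (hq i) (mul_nonneg ht (hp i))).ne'
  have h : HasDerivAt (fun t => q i + t * p i) (p i) t := by
    simpa using ((hasDerivAt_id t).mul_const (p i)).const_add (q i)
  rw [sq, mul_div_assoc]
  exact ((h.log hpos).const_mul (p i)).const_mul (w i)

/-- After subtracting `log t`, the weighted sum of `p log (q + t p)` tends to that of `p log p`. -/
lemma tendsto_sum_mul_log (w p q : ι → ℝ) (hp : ∀ i, 0 ≤ p i) :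
    Tendsto (fun t => ∑ i, w i * (p i * Real.log (q i + t * p i)) - Real.log t * ∑ i, w i * p i)
      atTop (𝓝 (∑ i, w i * (p i * Real.log (p i)))) := by
  have hterm : ∀ i, Tendsto (fun t => w i * (p i * (Real.log (q i + t * p i) - Real.log t)))
      atTop (𝓝 (w i * (p i * Real.log (p i)))) := by
    intro i
    rcases (hp i).eq_or_lt with h | h
    · simp [← h]
    · refine ((Tendsto.const_mul _ ?_).const_mul _)
      have h1 : Tendsto (fun t : ℝ => q i / t + p i) atTop (𝓝 (p i)) := by
        simpa using (tendsto_const_nhds.div_atTop tendsto_id).add_const (p i)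
      refine (h1.log h.ne').congr' ?_
      filter_upwards [eventually_gt_atTop 0, h1.eventually (lt_mem_nhds h)] with t ht hpos
      have : q i + t * p i = (q i / t + p i) * t := by field_simp
      rw [this, Real.log_mul hpos.ne' ht.ne', add_sub_cancel_right]
  refine (tendsto_finsetSum _ fun i _ => hterm i).congr fun t => ?_
  rw [Finset.mul_sum, ← Finset.sum_sub_distrib]
  exact Finset.sum_congr rfl fun i _ => by ring

/-- Integrating the inequality between the resolvent forms `p² / (q + t p)` over `t` gives the
inequality between the relative entropies `p (log p - log q)`. -/
lemma sum_mul_log_sub_log_le (w p q : ι → ℝ) (w' p' q' : κ → ℝ)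
    (hp : ∀ i, 0 ≤ p i) (hq : ∀ i, 0 < q i) (hp' : ∀ i, 0 ≤ p' i) (hq' : ∀ i, 0 < q' i)
    (hsum : ∑ i, w' i * p' i = ∑ i, w i * p i)
    (hle : ∀ t : ℝ, 0 ≤ t →
      ∑ i, w' i * (p' i ^ 2 / (q' i + t * p' i)) ≤ ∑ i, w i * (p i ^ 2 / (q i + t * p i))) :
    ∑ i, w' i * (p' i * Real.log (p' i)) - ∑ i, w' i * (p' i * Real.log (q' i)) ≤
      ∑ i, w i * (p i * Real.log (p i)) - ∑ i, w i * (p i * Real.log (q i)) := by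
  have hd := fun t (ht : (0 : ℝ) ≤ t) => (hasDerivAt_sum_mul_log w p q hp hq ht).sub
    (hasDerivAt_sum_mul_log w' p' q' hp' hq' ht)
  have hmono := monotoneOn_of_deriv_nonneg (convex_Ici (0 : ℝ))
    (fun t ht => (hd t ht).continuousAt.continuousWithinAt)
    (fun t ht => (hd t (interior_subset ht)).differentiableAt.differentiableWithinAt)
    (fun t ht => by
      rw [(hd t (interior_subset ht)).deriv]
      exact sub_nonneg.2 (hle t (interior_subset ht)))
  refine le_of_tendsto_of_tendsto
    ((tendsto_sum_mul_log w' p' q' hp').sub_const _) ((tendsto_sum_mul_log w p q hp).sub_const _) ?_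
  filter_upwards [eventually_ge_atTop 0] with t ht
  have h := hmono (Set.mem_Ici.2 le_rfl) (Set.mem_Ici.2 ht) ht
  simp only [Pi.sub_apply, zero_mul, add_zero] at h
  rw [hsum]
  linarith

end Scalar

section Variational

variable {n m : Type*} [Fintype n] [DecidableEq n] [Fintype m] [DecidableEq m]

/-- The concave quadratic form whose maximum over `W` is the resolvent form of the relative
modular operator of `ρ` and `σ`. -/
noncomputable def resolventForm (ρ σ : Matrix n n ℂ) (t : ℝ) (W : Matrix n n ℂ) : ℝ :=
  2 * (trace (star W * ρ)).re - (trace (W * star W * σ)).re - t * (trace (star W * W * ρ)).re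

lemma trace_star_mul_mul_diagonal_re (X K : Matrix n n ℂ) (p : n → ℝ) :
    (trace (star X * K * diagonal fun i => (p i : ℂ))).re
      = ∑ x : n × n, (star (X x.1 x.2) * K x.1 x.2).re * p x.2 := by
  rw [trace, Fintype.sum_prod_type_right, Complex.re_sum]
  refine Finset.sum_congr rfl fun i _ => ?_
  rw [diag_apply, mul_diagonal, mul_apply, Complex.re_mul_ofReal, Complex.re_sum, Finset.sum_mul]
  rfl

/-- The Hermitian matrix with eigenvectors the columns of `U` and eigenvalues `p`. -/
noncomputable def unitaryDiag (U : unitaryGroup n ℂ) (p : n → ℝ) : Matrix n n ℂ :=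
  (U : Matrix n n ℂ) * (diagonal fun i => (p i : ℂ)) * star (U : Matrix n n ℂ)

lemma eq_unitaryDiag {M : Matrix n n ℂ} (h : M.IsHermitian) :
    M = unitaryDiag h.eigenvectorUnitary h.eigenvalues := by
  have hs := h.spectral_theorem
  rwa [Unitary.conjStarAlgAut_apply] at hs

lemma star_mul_unitaryDiag_mul (U : unitaryGroup n ℂ) (p : n → ℝ) :
    star (U : Matrix n n ℂ) * unitaryDiag U p * U = diagonal fun i => (p i : ℂ) := by
  have hU : star (U : Matrix n n ℂ) * U = 1 := Unitary.coe_star_mul_self U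
  rw [unitaryDiag, mul_assoc, mul_assoc, hU, mul_one, ← mul_assoc, hU, one_mul]

lemma resolventForm_eq_sum (U V : unitaryGroup n ℂ) (p q : n → ℝ) (t : ℝ) (X : Matrix n n ℂ) :
    resolventForm (unitaryDiag U p)
        (unitaryDiag V q) t
        ((V : Matrix n n ℂ) * X * star (U : Matrix n n ℂ)) =
      ∑ x : n × n,
        (2 * (star (X x.1 x.2) * (star (V : Matrix n n ℂ) * (U : Matrix n n ℂ)) x.1 x.2).re * p x.2
          - Complex.normSq (X x.1 x.2) * (q x.1 + t * p x.2)) := by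
  have hU : star (U : Matrix n n ℂ) * U = 1 := Unitary.coe_star_mul_self U
  have hV : star (V : Matrix n n ℂ) * V = 1 := Unitary.coe_star_mul_self V
  unfold unitaryDiag
  set u := (U : Matrix n n ℂ)
  set v := (V : Matrix n n ℂ)
  set P : Matrix n n ℂ := diagonal fun i => (p i : ℂ)
  set Q : Matrix n n ℂ := diagonal fun i => (q i : ℂ)
  have cu : ∀ Y : Matrix n n ℂ, star u * (u * Y) = Y := fun Y => by rw [← mul_assoc, hU, one_mul]
  have cv : ∀ Y : Matrix n n ℂ, star v * (v * Y) = Y := fun Y => by rw [← mul_assoc, hV, one_mul]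
  have h1 : trace (star (v * X * star u) * (u * P * star u)) = trace (star X * (star v * u) * P) := by
    rw [← mul_assoc, trace_mul_comm]
    simp only [star_mul, star_star, mul_assoc, cu]
  have h2 : trace (v * X * star u * star (v * X * star u) * (v * Q * star v))
      = trace (star (star X) * star X * Q) := by
    rw [← mul_assoc, trace_mul_comm]
    simp only [star_mul, star_star, mul_assoc, cu, cv]
  have h3 : trace (star (v * X * star u) * (v * X * star u) * (u * P * star u))
      = trace (star X * X * P) := by
    rw [← mul_assoc, trace_mul_comm]
    simp only [star_mul, star_star, mul_assoc, cu, cv]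
  have hsq : ∀ z : ℂ, (star z * z).re = Complex.normSq z := fun z => by
    rw [Complex.star_def, ← Complex.normSq_eq_conj_mul_self, Complex.ofReal_re]
  rw [resolventForm, h1, h2, h3, trace_star_mul_mul_diagonal_re, trace_star_mul_mul_diagonal_re,
    trace_star_mul_mul_diagonal_re, ← (Equiv.prodComm n n).sum_comp
      (fun x : n × n => (star (star X x.1 x.2) * star X x.1 x.2).re * q x.2),
    Finset.mul_sum, Finset.mul_sum, ← Finset.sum_sub_distrib, ← Finset.sum_sub_distrib]
  refine Finset.sum_congr rfl fun x _ => ?_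
  simp only [Equiv.prodComm_apply, Prod.fst_swap, Prod.snd_swap, star_apply, star_star, hsq]
  rw [mul_comm (X x.1 x.2) (star (X x.1 x.2)), hsq]
  ring

lemma two_re_mul_sub_le (x k : ℂ) (p : ℝ) {s : ℝ} (hs : 0 < s) :
    2 * (star x * k).re * p - Complex.normSq x * s ≤ Complex.normSq k * (p ^ 2 / s) := by
  rw [← mul_div_assoc, le_div_iff₀ hs]
  simp only [Complex.star_def, Complex.mul_re, Complex.conj_re, Complex.conj_im,
    Complex.normSq_apply]
  nlinarith [sq_nonneg (x.re * s - k.re * p), sq_nonneg (x.im * s - k.im * p)]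

lemma two_re_mul_sub_eq (k : ℂ) (p : ℝ) {s : ℝ} (hs : 0 < s) :
    2 * (star (((p / s : ℝ) : ℂ) * k) * k).re * p - Complex.normSq (((p / s : ℝ) : ℂ) * k) * s
      = Complex.normSq k * (p ^ 2 / s) := by
  simp only [Complex.star_def, Complex.mul_re, Complex.conj_re, Complex.conj_im,
    Complex.normSq_apply, Complex.mul_im, Complex.ofReal_re, Complex.ofReal_im]
  field_simp
  ring

variable (U V : unitaryGroup n ℂ) (p q : n → ℝ)

/-- Squared overlaps of the columns of two unitaries. -/
noncomputable def overlap (U V : unitaryGroup n ℂ) (x : n × n) : ℝ :=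
  Complex.normSq ((star (V : Matrix n n ℂ) * (U : Matrix n n ℂ)) x.1 x.2)

lemma resolventForm_le (hp : ∀ i, 0 ≤ p i) (hq : ∀ i, 0 < q i) {t : ℝ} (ht : 0 ≤ t)
    (W : Matrix n n ℂ) :
    resolventForm (unitaryDiag U p)
        (unitaryDiag V q) t W ≤
      ∑ x : n × n, overlap U V x * (p x.2 ^ 2 / (q x.1 + t * p x.2)) := by
  have hW : W = (V : Matrix n n ℂ) * (star (V : Matrix n n ℂ) * W * U) * star (U : Matrix n n ℂ) := by
    have hU : (U : Matrix n n ℂ) * star (U : Matrix n n ℂ) = 1 := Unitary.coe_mul_star_self U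
    have hV : (V : Matrix n n ℂ) * star (V : Matrix n n ℂ) = 1 := Unitary.coe_mul_star_self V
    rw [mul_assoc, mul_assoc, hU, mul_one, ← mul_assoc, hV, one_mul]
  rw [hW, resolventForm_eq_sum]
  exact Finset.sum_le_sum fun x _ => two_re_mul_sub_le _ _ _
    (add_pos_of_pos_of_nonneg (hq _) (mul_nonneg ht (hp _)))

lemma exists_resolventForm_eq (hp : ∀ i, 0 ≤ p i) (hq : ∀ i, 0 < q i) {t : ℝ} (ht : 0 ≤ t) :
    ∃ W, resolventForm (unitaryDiag U p)
        (unitaryDiag V q) t W =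
      ∑ x : n × n, overlap U V x * (p x.2 ^ 2 / (q x.1 + t * p x.2)) := by
  refine ⟨(V : Matrix n n ℂ) * (of fun j i => ((p i / (q j + t * p i) : ℝ) : ℂ) *
    (star (V : Matrix n n ℂ) * (U : Matrix n n ℂ)) j i) * star (U : Matrix n n ℂ), ?_⟩
  rw [resolventForm_eq_sum]
  exact Finset.sum_congr rfl fun x _ => two_re_mul_sub_eq _ _
    (add_pos_of_pos_of_nonneg (hq _) (mul_nonneg ht (hp _)))

lemma sum_overlap_mul (f : n → ℝ) : ∑ x : n × n, overlap U V x * f x.2 = ∑ i, f i := by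
  rw [Fintype.sum_prod_type_right]
  refine Finset.sum_congr rfl fun i _ => ?_
  have h : star (star (V : Matrix n n ℂ) * (U : Matrix n n ℂ)) * (star (V : Matrix n n ℂ) * U)
      = 1 := by
    have hU : star (U : Matrix n n ℂ) * U = 1 := Unitary.coe_star_mul_self U
    have hV : (V : Matrix n n ℂ) * star (V : Matrix n n ℂ) = 1 := Unitary.coe_mul_star_self V
    rw [star_mul, star_star, mul_assoc, ← mul_assoc (V : Matrix n n ℂ), hV, one_mul, hU]
  have h' := congrArg Complex.re (congrFun (congrFun h i) i)
  rw [mul_apply, Complex.re_sum, one_apply_eq, Complex.one_re] at h'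
  change ∑ j, overlap U V (j, i) * f i = f i
  rw [← Finset.sum_mul]
  refine (congrArg (· * f i) (Eq.trans ?_ h')).trans (one_mul _)
  refine Finset.sum_congr rfl fun j _ => ?_
  rw [star_apply, Complex.star_def, ← Complex.normSq_eq_conj_mul_self, Complex.ofReal_re]
  rfl

lemma sum_overlap_mul_mul (f : n → ℝ) :
    ∑ x : n × n, overlap U V x * (p x.2 * f x.1) =
      ∑ j, ((star (V : Matrix n n ℂ) *
        (unitaryDiag U p) * V) j j).re * f j := by
  rw [Fintype.sum_prod_type]
  refine Finset.sum_congr rfl fun j _ => ?_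
  have h : star (V : Matrix n n ℂ) *
      unitaryDiag U p * V =
      (star (V : Matrix n n ℂ) * U) * (diagonal fun i => (p i : ℂ)) *
        star (star (V : Matrix n n ℂ) * U) := by
    simp only [unitaryDiag, star_mul, star_star, mul_assoc]
  rw [h, mul_apply, Complex.re_sum, Finset.sum_mul]
  refine Finset.sum_congr rfl fun i _ => ?_
  rw [mul_diagonal, star_apply, Complex.star_def, mul_right_comm, Complex.mul_conj,
    ← Complex.ofReal_mul, Complex.ofReal_re, overlap, mul_assoc]

/-- Monotonicity of the relative entropy under the adjoint of a `*`-homomorphism `f`. -/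
lemma relEntropy_mono (U' V' : unitaryGroup m ℂ) (p' q' : m → ℝ)
    (hp : ∀ i, 0 ≤ p i) (hq : ∀ i, 0 < q i) (hp' : ∀ i, 0 ≤ p' i) (hq' : ∀ i, 0 < q' i)
    {ρ σ : Matrix n n ℂ} {ρ' σ' : Matrix m m ℂ}
    (hρ : ρ = unitaryDiag U p)
    (hσ : σ = unitaryDiag V q)
    (hρ' : ρ' = unitaryDiag U' p')
    (hσ' : σ' = unitaryDiag V' q')
    (hsum : ∑ i, p' i = ∑ i, p i)
    (f : Matrix m m ℂ → Matrix n n ℂ) (hmul : ∀ X Y, f (X * Y) = f X * f Y)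
    (hstar : ∀ X, f (star X) = star (f X))
    (hfρ : ∀ X, trace (f X * ρ) = trace (X * ρ')) (hfσ : ∀ X, trace (f X * σ) = trace (X * σ')) :
    ∑ i, p' i * Real.log (p' i) -
        ∑ j, ((star (V' : Matrix m m ℂ) * ρ' * V') j j).re * Real.log (q' j) ≤
      ∑ i, p i * Real.log (p i) -
        ∑ j, ((star (V : Matrix n n ℂ) * ρ * V) j j).re * Real.log (q j) := by
  have hform : ∀ t W, resolventForm ρ σ t (f W) = resolventForm ρ' σ' t W := fun t W => by
    simp only [resolventForm, ← hstar, ← hmul, hfρ, hfσ]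
  have key := sum_mul_log_sub_log_le (overlap U V) (fun x => p x.2) (fun x => q x.1)
    (overlap U' V') (fun x => p' x.2) (fun x => q' x.1) (fun _ => hp _) (fun _ => hq _)
    (fun _ => hp' _) (fun _ => hq' _) (by rw [sum_overlap_mul, sum_overlap_mul, hsum])
    (fun t ht => by
      obtain ⟨W, hW⟩ := exists_resolventForm_eq U' V' p' q' hp' hq' ht
      rw [← hW, ← hρ', ← hσ', ← hform, hρ, hσ]
      exact resolventForm_le U V p q hp hq ht _)
  rw [sum_overlap_mul U V fun i => p i * Real.log (p i),
    sum_overlap_mul U' V' fun i => p' i * Real.log (p' i),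
    sum_overlap_mul_mul U V p fun j => Real.log (q j),
    sum_overlap_mul_mul U' V' p' fun j => Real.log (q' j), ← hρ, ← hρ'] at key
  exact key

end Variational

section PartialTrace

variable {A B C X : Type*} [Fintype A] [DecidableEq A] [Fintype B] [DecidableEq B]
  [Fintype C] [DecidableEq C] [Fintype X] [DecidableEq X]

/-- Partial trace over the first factor. -/
noncomputable def traceFst (ρ : Matrix (A × X) (A × X) ℂ) : Matrix X X ℂ :=
  of fun x y => ∑ a, ρ (a, x) (a, y)

/-- The matrix `M ⊗ 1` acting on `A × B × C`. -/
noncomputable def extendC (C : Type*) [DecidableEq C] (M : Matrix (A × B) (A × B) ℂ) :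
    Matrix (A × B × C) (A × B × C) ℂ :=
  of fun x y => if x.2.2 = y.2.2 then M (x.1, x.2.1) (y.1, y.2.1) else 0

omit [DecidableEq A] [DecidableEq B] in
lemma extendC_mul (M N : Matrix (A × B) (A × B) ℂ) :
    extendC C (M * N) = extendC C M * extendC C N := by
  ext x y
  simp only [extendC, mul_apply, of_apply, Fintype.sum_prod_type]
  split_ifs with h <;> simp [h]

omit [Fintype A] [DecidableEq A] [Fintype B] [DecidableEq B] [Fintype C] in
lemma extendC_star (M : Matrix (A × B) (A × B) ℂ) : extendC C (star M) = star (extendC C M) := by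
  ext x y
  simp only [extendC, star_apply, of_apply, eq_comm (a := x.2.2)]
  split_ifs <;> simp

omit [DecidableEq A] [DecidableEq B] in
lemma trace_extendC_mul (M : Matrix (A × B) (A × B) ℂ) (ρ : Matrix (A × B × C) (A × B × C) ℂ) :
    trace (extendC C M * ρ) = trace (M * margAB ρ) := by
  simp only [trace, diag_apply, mul_apply, extendC, margAB, of_apply, Fintype.sum_prod_type,
    ite_mul, zero_mul, Finset.sum_ite_eq, Finset.mem_univ, if_true, Finset.mul_sum]
  refine Finset.sum_congr rfl fun a _ => Finset.sum_congr rfl fun b _ => ?_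
  rw [Finset.sum_comm]
  exact Finset.sum_congr rfl fun a' _ => Finset.sum_comm

omit [Fintype A] [DecidableEq A] [Fintype B] [DecidableEq B] [DecidableEq C] in
lemma margAB_posSemidef {ρ : Matrix (A × B × C) (A × B × C) ℂ} (h : ρ.PosSemidef) :
    (margAB ρ).PosSemidef := by
  have : margAB ρ = ∑ c : C, ρ.submatrix (fun x : A × B => (x.1, x.2, c)) (fun x => (x.1, x.2, c)) := by
    ext x y
    simp [margAB, Matrix.sum_apply]
  rw [this]
  exact posSemidef_sum _ fun c _ => h.submatrix _

omit [DecidableEq A] [Fintype X] [DecidableEq X] in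
lemma traceFst_posSemidef {ρ : Matrix (A × X) (A × X) ℂ} (h : ρ.PosSemidef) :
    (traceFst ρ).PosSemidef := by
  have : traceFst ρ = ∑ a : A, ρ.submatrix (fun x : X => (a, x)) (fun x => (a, x)) := by
    ext x y
    simp [traceFst, Matrix.sum_apply]
  rw [this]
  exact posSemidef_sum _ fun a _ => h.submatrix _

/-- The unitary `1 ⊗ V`. -/
noncomputable def oneKroneckerUnitary (A : Type*) [Fintype A] [DecidableEq A]
    (V : unitaryGroup X ℂ) : unitaryGroup (A × X) ℂ :=
  ⟨(1 : Matrix A A ℂ) ⊗ₖ (V : Matrix X X ℂ), kronecker_mem_unitary (one_mem _) V.2⟩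

lemma star_oneKroneckerUnitary (V : unitaryGroup X ℂ) :
    star (oneKroneckerUnitary A V : Matrix (A × X) (A × X) ℂ) =
      (1 : Matrix A A ℂ) ⊗ₖ star (V : Matrix X X ℂ) := by
  simp [oneKroneckerUnitary, star_eq_conjTranspose, conjTranspose_kronecker]

lemma one_kronecker_add_smul_eq {κ : Matrix X X ℂ} (h : κ.IsHermitian) (ε : ℝ) :
    (1 : Matrix A A ℂ) ⊗ₖ (κ + (ε : ℂ) • (1 : Matrix X X ℂ)) =
      unitaryDiag (oneKroneckerUnitary A h.eigenvectorUnitary) fun x => h.eigenvalues x.2 + ε := by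
  have hd : (diagonal fun x : A × X => ((h.eigenvalues x.2 + ε : ℝ) : ℂ)) =
      (1 : Matrix A A ℂ) ⊗ₖ (diagonal fun i => (h.eigenvalues i : ℂ)) + (ε : ℂ) • 1 := by
    rw [← diagonal_one, diagonal_kronecker_diagonal, ← diagonal_one, ← diagonal_smul, diagonal_add]
    congr 1
    ext x
    simp
  have hV : (oneKroneckerUnitary A h.eigenvectorUnitary : Matrix (A × X) (A × X) ℂ) *
      star (oneKroneckerUnitary A h.eigenvectorUnitary : Matrix (A × X) (A × X) ℂ) = 1 :=
    Unitary.coe_mul_star_self _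
  rw [unitaryDiag, hd, mul_add, add_mul, mul_smul_comm, smul_mul_assoc, mul_one, hV,
    star_oneKroneckerUnitary, oneKroneckerUnitary, ← mul_kronecker_mul, ← mul_kronecker_mul,
    one_mul, one_mul, kronecker_add, kronecker_smul, one_kronecker_one]
  congr 2
  exact eq_unitaryDiag h

/-- `Tr ρ (1 ⊗ G) = Tr ρ_X G` for `G` diagonal in the eigenbasis of `ρ_X`. -/
lemma sum_conj_oneKroneckerUnitary (ρ : Matrix (A × X) (A × X) ℂ)
    (h : (traceFst ρ).IsHermitian) (g : X → ℝ) :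
    ∑ j : A × X, ((star (oneKroneckerUnitary A h.eigenvectorUnitary : Matrix (A × X) (A × X) ℂ) *
      ρ * oneKroneckerUnitary A h.eigenvectorUnitary) j j).re * g j.2 =
      ∑ x, h.eigenvalues x * g x := by
  have hV : ∀ x, h.eigenvalues x = ((star (h.eigenvectorUnitary : Matrix X X ℂ) * traceFst ρ *
      h.eigenvectorUnitary) x x).re := fun x => by
    have hd := star_mul_unitaryDiag_mul h.eigenvectorUnitary h.eigenvalues
    rw [← eq_unitaryDiag h] at hd
    rw [hd, diagonal_apply_eq, Complex.ofReal_re]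
  rw [Fintype.sum_prod_type_right]
  refine Finset.sum_congr rfl fun x _ => ?_
  refine (Finset.sum_mul _ _ _).symm.trans (congrArg (· * g x) ?_)
  rw [hV, ← Complex.re_sum, star_oneKroneckerUnitary]
  congr 1
  simp only [oneKroneckerUnitary, mul_apply, traceFst, of_apply, kronecker_apply,
    Fintype.sum_prod_type, one_apply, ite_mul, mul_ite, zero_mul, mul_zero, one_mul,
    Finset.sum_ite_irrel, Finset.sum_const_zero, Finset.sum_ite_eq, Finset.sum_ite_eq',
    Finset.mem_univ, if_true, Finset.mul_sum, Finset.sum_mul]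
  rw [Finset.sum_comm]
  refine Finset.sum_congr rfl fun y _ => ?_
  rw [Finset.sum_comm]

omit [DecidableEq X] in
lemma tendsto_sum_mul_log_add (r : X → ℝ) :
    Tendsto (fun ε => ∑ x, r x * Real.log (r x + ε)) (𝓝[>] 0)
      (𝓝 (∑ x, r x * Real.log (r x))) := by
  refine tendsto_finsetSum _ fun x _ => ?_
  by_cases h : r x = 0
  · simp [h]
  · have h0 : Tendsto (fun ε : ℝ => r x + ε) (𝓝[>] 0) (𝓝 (r x)) := by
      simpa using ((tendsto_id (x := 𝓝 (0 : ℝ))).mono_left nhdsWithin_le_nhds).const_add (r x)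
    exact (h0.log h).const_mul _

end PartialTrace

section StrongSubadditivity

variable {A B C : Type*} [Fintype A] [DecidableEq A] [Fintype B] [DecidableEq B]
  [Fintype C] [DecidableEq C]

lemma vNEntropy_eq {n : Type*} [Fintype n] [DecidableEq n] {ρ : Matrix n n ℂ}
    (h : ρ.IsHermitian) :
    vNEntropy ρ = -∑ i, h.eigenvalues i * Real.log (h.eigenvalues i) := dif_pos h

omit [DecidableEq A] [DecidableEq B] [DecidableEq C] in
lemma trace_margAB (ρ : Matrix (A × B × C) (A × B × C) ℂ) : (margAB ρ).trace = ρ.trace := by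
  simp [trace, margAB, Fintype.sum_prod_type]

omit [Fintype A] [Fintype B] [DecidableEq B] [DecidableEq C] in
lemma margAB_one_kronecker (κ : Matrix (B × C) (B × C) ℂ) (μ : Matrix B B ℂ)
    (h : ∀ b b', ∑ c, κ (b, c) (b', c) = μ b b') :
    margAB ((1 : Matrix A A ℂ) ⊗ₖ κ) = (1 : Matrix A A ℂ) ⊗ₖ μ := by
  ext x y
  simp only [margAB, of_apply, kroneckerMap_apply]
  rw [← h, Finset.mul_sum]

omit [DecidableEq A] [Fintype B] [DecidableEq B] [DecidableEq C] in
lemma traceFst_margAB (ρ : Matrix (A × B × C) (A × B × C) ℂ) :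
    traceFst (margAB ρ) = margB ρ := rfl

/-- Strong subadditivity of the von Neumann entropy. -/
theorem vNEntropy_strong_subadditivity [Nonempty C] {ρ : Matrix (A × B × C) (A × B × C) ℂ}
    (hρ : ρ.PosSemidef) :
    vNEntropy ρ + vNEntropy (margB ρ) ≤ vNEntropy (margAB ρ) + vNEntropy (margBC ρ) := by
  have hAB := margAB_posSemidef hρ
  have hBC : (traceFst ρ).PosSemidef := traceFst_posSemidef hρ
  have hB : (traceFst (margAB ρ)).PosSemidef := traceFst_posSemidef hAB
  have hcard : (0 : ℝ) < Fintype.card C := by exact_mod_cast Fintype.card_pos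
  have hmono : ∀ ε : ℝ, 0 < ε →
      ∑ i, hAB.1.eigenvalues i * Real.log (hAB.1.eigenvalues i) -
        ∑ x, hB.1.eigenvalues x * Real.log (hB.1.eigenvalues x + Fintype.card C * ε) ≤
      ∑ i, hρ.1.eigenvalues i * Real.log (hρ.1.eigenvalues i) -
        ∑ x, hBC.1.eigenvalues x * Real.log (hBC.1.eigenvalues x + ε) := by
    intro ε hε
    have hmarg : margAB ((1 : Matrix A A ℂ) ⊗ₖ (traceFst ρ + (ε : ℂ) • (1 : Matrix (B × C) _ ℂ))) =
        (1 : Matrix A A ℂ) ⊗ₖ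
          (traceFst (margAB ρ) + ((Fintype.card C * ε : ℝ) : ℂ) • (1 : Matrix B B ℂ)) := by
      refine margAB_one_kronecker _ _ fun b b' => ?_
      simp only [traceFst, margAB, Matrix.add_apply, of_apply, Matrix.smul_apply, one_apply, Prod.mk.injEq,
        and_true, Finset.sum_add_distrib, smul_eq_mul, Finset.sum_const, Finset.card_univ,
        nsmul_eq_mul, Complex.ofReal_mul, Complex.ofReal_natCast, mul_assoc]
      rw [Finset.sum_comm]
    have hsum : ∑ i, hAB.1.eigenvalues i = ∑ i, hρ.1.eigenvalues i := by
      have h := trace_margAB ρ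
      rw [hAB.1.trace_eq_sum_eigenvalues, hρ.1.trace_eq_sum_eigenvalues] at h
      exact_mod_cast h
    have key := relEntropy_mono hρ.1.eigenvectorUnitary
      (oneKroneckerUnitary A hBC.1.eigenvectorUnitary) hρ.1.eigenvalues
      (fun x => hBC.1.eigenvalues x.2 + ε) hAB.1.eigenvectorUnitary
      (oneKroneckerUnitary A hB.1.eigenvectorUnitary) hAB.1.eigenvalues
      (fun x => hB.1.eigenvalues x.2 + Fintype.card C * ε)
      hρ.eigenvalues_nonneg (fun x => add_pos_of_nonneg_of_pos (hBC.eigenvalues_nonneg _) hε)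
      hAB.eigenvalues_nonneg
      (fun x => add_pos_of_nonneg_of_pos (hB.eigenvalues_nonneg _) (mul_pos hcard hε))
      (eq_unitaryDiag hρ.1) (one_kronecker_add_smul_eq hBC.1 ε) (eq_unitaryDiag hAB.1)
      (one_kronecker_add_smul_eq hB.1 (Fintype.card C * ε)) hsum (extendC C) extendC_mul
      extendC_star (fun M => trace_extendC_mul M ρ)
      (fun M => by rw [trace_extendC_mul, hmarg])
    rwa [sum_conj_oneKroneckerUnitary ρ hBC.1 fun x => Real.log (hBC.1.eigenvalues x + ε),
      sum_conj_oneKroneckerUnitary (margAB ρ) hB.1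
        fun x => Real.log (hB.1.eigenvalues x + Fintype.card C * ε)] at key
  have hscale : Tendsto (fun ε : ℝ => Fintype.card C * ε) (𝓝[>] 0) (𝓝[>] 0) := by
    refine tendsto_nhdsWithin_iff.2 ⟨?_, ?_⟩
    · simpa using ((tendsto_id (x := 𝓝 (0 : ℝ))).mono_left nhdsWithin_le_nhds).const_mul
        (Fintype.card C : ℝ)
    · filter_upwards [self_mem_nhdsWithin] with ε hε using mul_pos hcard hε
  have hlim := le_of_tendsto_of_tendsto
    (((tendsto_sum_mul_log_add hB.1.eigenvalues).comp hscale).const_sub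
      (∑ i, hAB.1.eigenvalues i * Real.log (hAB.1.eigenvalues i)))
    ((tendsto_sum_mul_log_add hBC.1.eigenvalues).const_sub
      (∑ i, hρ.1.eigenvalues i * Real.log (hρ.1.eigenvalues i)))
    (by filter_upwards [self_mem_nhdsWithin] with ε hε using hmono ε hε)
  have e1 := vNEntropy_eq hρ.1
  have e2 := vNEntropy_eq hAB.1
  have e3 : vNEntropy (margBC ρ) = _ := vNEntropy_eq hBC.1
  have e4 : vNEntropy (margB ρ) = _ := vNEntropy_eq hB.1
  linarith

end StrongSubadditivity

/-- For density matrices `ρ`, `σ` with equal `AB` and `BC` marginals and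
`τ = (ρ + σ)/2`, one has `S(τ) - (S(ρ) + S(σ))/2 ≤ (I(A:C|B)_ρ + I(A:C|B)_σ)/2`. -/
theorem entropy_of_average_bounded_by_average_CMI
    {A B C : Type*} [Fintype A] [DecidableEq A] [Fintype B] [DecidableEq B]
    [Fintype C] [DecidableEq C]
    (ρ σ : Matrix (A × B × C) (A × B × C) ℂ)
    (hρ : IsDensityMatrix ρ) (hσ : IsDensityMatrix σ)
    (hAB : margAB ρ = margAB σ) (hBC : margBC ρ = margBC σ)
    (τ : Matrix (A × B × C) (A × B × C) ℂ)
    (hτ : τ = ((1 : ℂ) / 2) • (ρ + σ)) :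
    vNEntropy τ - (vNEntropy ρ + vNEntropy σ) / 2 ≤ (CMI ρ + CMI σ) / 2 := by
  have hC : Nonempty C := by
    by_contra h
    rw [not_nonempty_iff] at h
    have := hρ.2
    simp [trace] at this
  have hB : margB σ = margB ρ := by rw [← traceFst_margAB, ← traceFst_margAB, hAB]
  have hτpos : τ.PosSemidef := hτ ▸ (hρ.1.add hσ.1).smul (by positivity)
  have hτAB : margAB τ = margAB ρ := by
    ext x y
    have h := congrFun (congrFun hAB x) y
    simp only [margAB, of_apply] at h
    simp only [hτ, margAB, of_apply, Matrix.smul_apply, Matrix.add_apply, smul_eq_mul, ← Finset.mul_sum,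
      Finset.sum_add_distrib, ← h]
    ring
  have hτBC : margBC τ = margBC ρ := by
    ext x y
    have h := congrFun (congrFun hBC x) y
    simp only [margBC, of_apply] at h
    simp only [hτ, margBC, of_apply, Matrix.smul_apply, Matrix.add_apply, smul_eq_mul, ← Finset.mul_sum,
      Finset.sum_add_distrib, ← h]
    ring
  have hτB : margB τ = margB ρ := by rw [← traceFst_margAB, ← traceFst_margAB, hτAB]
  have h := vNEntropy_strong_subadditivity hτpos
  rw [hτAB, hτBC, hτB] at h
  simp only [CMI, ← hAB, ← hBC, hB]
  linarith
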